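/- Let α ∈ (0,1), β ∈ (α+1, 2), ν > 0, and let c_α > 0, c_β > 0 be given constants. Then there exist δ, γ with 0 < γ < δ ≤ 1/9 such that for every ξ > 0 one has c_α · Ω₁[ω_{δ,γ}](ξ) · D(ξ) + ν c_β · Υ_β[ω_{δ,γ}](ξ) < 0, where D(ξ) = 1 − (3/2)ξ^{1/2} for 0 < ξ ≤ δ and D(ξ) = γ/(4(ξ + ξ^β)) for ξ > δ. -/

import Mathlib

open MeasureTheory Set Real

/-- The modulus of continuity `ω_{δ,γ}` from Section 4 (equation (4.13)):
`ω(ξ) = ξ - ξ^{3/2}` for `0 < ξ ≤ δ` and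
`ω(ξ) = δ - δ^{3/2} + ∫_δ^ξ γ/(4(η + η^β)) dη` for `ξ > δ`. -/
noncomputable def omegaDG (β δ γ ξ : ℝ) : ℝ :=
  if ξ ≤ δ then ξ - ξ ^ ((3 : ℝ) / 2)
  else δ - δ ^ ((3 : ℝ) / 2) + ∫ η in Set.Ioc δ ξ, γ / (4 * (η + η ^ β))

/-- `Ω₁[ω](ξ) := ∫₀^ξ ω(η) η^{−(1+α)} dη + ξ ∫_ξ^∞ ω(η) η^{−(2+α)} dη`. -/
noncomputable def Omega1 (α : ℝ) (ω : ℝ → ℝ) (ξ : ℝ) : ℝ :=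
  (∫ η in Set.Ioc (0 : ℝ) ξ, ω η / η ^ (1 + α)) +
    ξ * ∫ η in Set.Ioi ξ, ω η / η ^ (2 + α)

/-- The dissipation functional
`Υ_β[ω](ξ) := ∫₀^{ξ/2} (ω(ξ+2η) + ω(ξ−2η) − 2ω(ξ)) η^{−(1+β)} dη
  + ∫_{ξ/2}^∞ (ω(2η+ξ) − ω(2η−ξ) − 2ω(ξ)) η^{−(1+β)} dη`. -/
noncomputable def Upsilon (β : ℝ) (ω : ℝ → ℝ) (ξ : ℝ) : ℝ :=
  (∫ η in Set.Ioc (0 : ℝ) (ξ / 2),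
      (ω (ξ + 2 * η) + ω (ξ - 2 * η) - 2 * ω ξ) / η ^ (1 + β)) +
    ∫ η in Set.Ioi (ξ / 2), (ω (2 * η + ξ) - ω (2 * η - ξ) - 2 * ω ξ) / η ^ (1 + β)

lemma slope_antitoneOn {β γ : ℝ} (hβ : 0 ≤ β) (hγ : 0 ≤ γ) :
    AntitoneOn (fun η : ℝ => γ / (4 * (η + η ^ β))) (Ioi 0) := by
  intro x hx y hy hxy
  have hx : 0 < x := hx
  have h := rpow_le_rpow hx.le hxy hβ
  have h' := rpow_pos_of_pos hx β
  dsimp only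
  gcongr

lemma slope_integrableOn {β γ x y : ℝ} (hβ : 0 ≤ β) (hγ : 0 ≤ γ) (hx : 0 < x) :
    IntegrableOn (fun η : ℝ => γ / (4 * (η + η ^ β))) (Ioc x y) :=
  (((slope_antitoneOn hβ hγ).mono
    (fun _ hz => hx.trans_le hz.1)).integrableOn_isCompact isCompact_Icc).mono_set
      Ioc_subset_Icc_self

lemma slope_nonneg {β γ η : ℝ} (hγ : 0 ≤ γ) (hη : 0 ≤ η) : 0 ≤ γ / (4 * (η + η ^ β)) := by
  have := rpow_nonneg hη β
  positivity

/-- The increment of the integral part of the modulus lies between its extreme slopes. -/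
lemma slope_integral_bounds {β γ δ x y : ℝ} (hβ : 0 ≤ β) (hγ : 0 ≤ γ) (hδ : 0 < δ)
    (hx : δ ≤ x) (hxy : x ≤ y) :
    γ / (4 * (y + y ^ β)) * (y - x) ≤
        (∫ η in Ioc δ y, γ / (4 * (η + η ^ β))) - ∫ η in Ioc δ x, γ / (4 * (η + η ^ β)) ∧
      (∫ η in Ioc δ y, γ / (4 * (η + η ^ β))) - ∫ η in Ioc δ x, γ / (4 * (η + η ^ β)) ≤
        γ / (4 * (x + x ^ β)) * (y - x) := by
  have hx0 : 0 < x := hδ.trans_le hx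
  have hsplit : ∫ η in Ioc δ y, γ / (4 * (η + η ^ β)) =
      (∫ η in Ioc δ x, γ / (4 * (η + η ^ β))) + ∫ η in Ioc x y, γ / (4 * (η + η ^ β)) := by
    rw [← Ioc_union_Ioc_eq_Ioc hx hxy]
    exact setIntegral_union (Ioc_disjoint_Ioc_of_le le_rfl) measurableSet_Ioc
      (slope_integrableOn hβ hγ hδ) (slope_integrableOn hβ hγ hx0)
  have hconst : ∀ c : ℝ, ∫ _ in Ioc x y, c = c * (y - x) := by
    intro c
    rw [setIntegral_const, smul_eq_mul, Real.volume_real_Ioc_of_le hxy, mul_comm]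
  have hci : ∀ c : ℝ, IntegrableOn (fun _ : ℝ => c) (Ioc x y) := fun c =>
    integrableOn_const (by simp)
  rw [hsplit, add_sub_cancel_left]
  constructor
  · rw [← hconst]
    refine setIntegral_mono_on (hci _) (slope_integrableOn hβ hγ hx0) measurableSet_Ioc ?_
    intro η hη
    exact slope_antitoneOn hβ hγ (mem_Ioi.2 (hx0.trans hη.1))
      (mem_Ioi.2 (hx0.trans_le hxy)) hη.2
  · rw [← hconst]
    refine setIntegral_mono_on (slope_integrableOn hβ hγ hx0) (hci _) measurableSet_Ioc ?_
    intro η hη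
    exact slope_antitoneOn hβ hγ (mem_Ioi.2 hx0) (mem_Ioi.2 (hx0.trans hη.1)) hη.1.le

/-- The one-sided derivative of `omegaDG`, a supergradient by `omegaDG_le_tangent`. -/
noncomputable def omegaDGSlope (β δ γ ξ : ℝ) : ℝ :=
  if ξ ≤ δ then 1 - (3 / 2) * ξ ^ ((1 : ℝ) / 2) else γ / (4 * (ξ + ξ ^ β))

lemma omegaDG_of_ge {β δ γ ξ : ℝ} (h : δ ≤ ξ) :
    omegaDG β δ γ ξ = δ - δ ^ ((3 : ℝ) / 2) + ∫ η in Ioc δ ξ, γ / (4 * (η + η ^ β)) := by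
  rcases h.eq_or_lt with rfl | h
  · simp [omegaDG]
  · simp [omegaDG, not_le.2 h]

lemma rpow_three_halves {x : ℝ} (hx : 0 ≤ x) : x ^ ((3 : ℝ) / 2) = √x ^ 3 := by
  rw [Real.sqrt_eq_rpow, ← rpow_natCast, ← rpow_mul hx]
  norm_num

lemma sub_rpow_le_tangent {x y : ℝ} (hx : 0 ≤ x) (hy : 0 ≤ y) :
    y - y ^ ((3 : ℝ) / 2) ≤
      x - x ^ ((3 : ℝ) / 2) + (1 - (3 / 2) * x ^ ((1 : ℝ) / 2)) * (y - x) := by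
  rw [rpow_three_halves hx, rpow_three_halves hy, ← Real.sqrt_eq_rpow]
  obtain ⟨a, ha, rfl⟩ : ∃ a, 0 ≤ a ∧ a ^ 2 = x := ⟨√x, sqrt_nonneg x, sq_sqrt hx⟩
  obtain ⟨b, hb, rfl⟩ : ∃ b, 0 ≤ b ∧ b ^ 2 = y := ⟨√y, sqrt_nonneg y, sq_sqrt hy⟩
  rw [sqrt_sq ha, sqrt_sq hb]
  nlinarith [mul_nonneg (sq_nonneg (b - a)) (by positivity : 0 ≤ 2 * b + a)]

lemma half_le_one_sub_sqrt {x : ℝ} (hx : x ≤ 1 / 9) :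
    1 / 2 ≤ 1 - (3 / 2) * x ^ ((1 : ℝ) / 2) := by
  rw [← Real.sqrt_eq_rpow]
  have : √x ≤ 1 / 3 := Real.sqrt_le_iff.2 ⟨by norm_num, by linarith⟩
  linarith

lemma slope_le {β δ γ x : ℝ} (hγδ : γ ≤ δ) (hδ : 0 < δ) (hx : δ ≤ x) :
    γ / (4 * (x + x ^ β)) ≤ 1 / 4 := by
  have hx0 : 0 < x := hδ.trans_le hx
  have := rpow_pos_of_pos hx0 β
  rw [div_le_iff₀ (by positivity)]
  linarith

lemma omegaDG_le_tangent {β δ γ x y : ℝ} (hβ : 0 ≤ β) (hγ : 0 ≤ γ) (hγδ : γ ≤ δ) (hδ : 0 < δ)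
    (hδ9 : δ ≤ 1 / 9) (hx : 0 ≤ x) (hy : 0 ≤ y) :
    omegaDG β δ γ y ≤ omegaDG β δ γ x + omegaDGSlope β δ γ x * (y - x) := by
  rcases le_or_gt x δ with hxδ | hxδ <;> rcases le_or_gt y δ with hyδ | hyδ
  · simpa only [omegaDG, omegaDGSlope, if_pos hxδ, if_pos hyδ] using sub_rpow_le_tangent hx hy
  · have h1 := (slope_integral_bounds hβ hγ hδ le_rfl hyδ.le).2
    have h2 := slope_le (β := β) hγδ hδ le_rfl
    have h3 := half_le_one_sub_sqrt (hxδ.trans hδ9)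
    have h4 := sub_rpow_le_tangent hx hδ.le
    rw [Ioc_self, setIntegral_empty, sub_zero] at h1
    rw [omegaDG_of_ge hyδ.le, omegaDG, omegaDGSlope, if_pos hxδ, if_pos hxδ]
    nlinarith
  · have h1 := (slope_integral_bounds hβ hγ hδ le_rfl hxδ.le).1
    have h2 := slope_le (β := β) hγδ hδ hxδ.le
    have h3 := half_le_one_sub_sqrt hδ9
    have h4 := sub_rpow_le_tangent hδ.le hy
    rw [Ioc_self, setIntegral_empty, sub_zero] at h1
    rw [omegaDG_of_ge hxδ.le, omegaDG, omegaDGSlope, if_pos hyδ, if_neg hxδ.not_ge]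
    nlinarith
  · rw [omegaDG_of_ge hxδ.le, omegaDG_of_ge hyδ.le, omegaDGSlope, if_neg hxδ.not_ge]
    rcases le_total x y with hxy | hxy
    · linarith [(slope_integral_bounds hβ hγ hδ hxδ.le hxy).2]
    · linarith [(slope_integral_bounds hβ hγ hδ hyδ.le hxy).1]

lemma omegaDGSlope_nonneg {β δ γ x : ℝ} (hγ : 0 ≤ γ) (hδ9 : δ ≤ 1 / 9) (hx : 0 ≤ x) :
    0 ≤ omegaDGSlope β δ γ x := by
  unfold omegaDGSlope
  split_ifs with h
  · linarith [half_le_one_sub_sqrt (h.trans hδ9)]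
  · exact slope_nonneg hγ hx

lemma omegaDGSlope_le_one {β δ γ x : ℝ} (hγδ : γ ≤ δ) (hδ : 0 < δ) (hx : 0 ≤ x) :
    omegaDGSlope β δ γ x ≤ 1 := by
  unfold omegaDGSlope
  split_ifs with h
  · linarith [rpow_nonneg hx ((1 : ℝ) / 2)]
  · linarith [slope_le (β := β) hγδ hδ (not_le.1 h).le]

lemma omegaDG_zero {β δ γ : ℝ} (hδ : 0 < δ) : omegaDG β δ γ 0 = 0 := by
  rw [omegaDG, if_pos hδ.le, zero_rpow (by norm_num), sub_zero]

lemma omegaDG_monotoneOn {β δ γ : ℝ} (hβ : 0 ≤ β) (hγ : 0 ≤ γ) (hγδ : γ ≤ δ) (hδ : 0 < δ)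
    (hδ9 : δ ≤ 1 / 9) : MonotoneOn (omegaDG β δ γ) (Ici 0) := by
  intro x hx y hy hxy
  have h := omegaDG_le_tangent hβ hγ hγδ hδ hδ9 hy hx
  nlinarith [omegaDGSlope_nonneg (β := β) hγ hδ9 (mem_Ici.1 hy)]

lemma omegaDG_nonneg {β δ γ x : ℝ} (hβ : 0 ≤ β) (hγ : 0 ≤ γ) (hγδ : γ ≤ δ) (hδ : 0 < δ)
    (hδ9 : δ ≤ 1 / 9) (hx : 0 ≤ x) : 0 ≤ omegaDG β δ γ x := by
  rw [← omegaDG_zero (β := β) (γ := γ) hδ]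
  exact omegaDG_monotoneOn hβ hγ hγδ hδ hδ9 (mem_Ici.2 le_rfl) hx hx

lemma omegaDG_le_self {β δ γ x : ℝ} (hβ : 0 ≤ β) (hγ : 0 ≤ γ) (hγδ : γ ≤ δ) (hδ : 0 < δ)
    (hδ9 : δ ≤ 1 / 9) (hx : 0 ≤ x) : omegaDG β δ γ x ≤ x := by
  have h := omegaDG_le_tangent hβ hγ hγδ hδ hδ9 le_rfl hx
  rw [omegaDG_zero hδ] at h
  nlinarith [omegaDGSlope_le_one (β := β) hγδ hδ (le_refl 0)]

lemma omegaDG_add_le {β δ γ x y : ℝ} (hβ : 0 ≤ β) (hγ : 0 ≤ γ) (hγδ : γ ≤ δ) (hδ : 0 < δ)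
    (hδ9 : δ ≤ 1 / 9) (hx : 0 ≤ x) (hy : 0 ≤ y) :
    omegaDG β δ γ (x + y) ≤ omegaDG β δ γ x + omegaDG β δ γ y := by
  wlog hxy : y ≤ x generalizing x y
  · rw [add_comm x y, add_comm (omegaDG β δ γ x)]
    exact this hy hx (not_le.1 hxy).le
  have h1 := omegaDG_le_tangent hβ hγ hγδ hδ hδ9 hx (add_nonneg hx hy)
  have h2 := omegaDG_le_tangent hβ hγ hγδ hδ hδ9 hy le_rfl
  have h3 := omegaDG_le_tangent hβ hγ hγδ hδ hδ9 hx hy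
  have h4 := omegaDG_le_tangent hβ hγ hγδ hδ hδ9 hy hx
  rw [omegaDG_zero hδ] at h2
  rcases hxy.eq_or_lt with rfl | hlt
  · linarith
  · have : omegaDGSlope β δ γ x ≤ omegaDGSlope β δ γ y := by
      by_contra! hc
      nlinarith [mul_pos (sub_pos.2 hc) (sub_pos.2 hlt)]
    nlinarith

lemma omegaDG_add_sub_le {β δ γ x h : ℝ} (hβ : 0 ≤ β) (hγ : 0 ≤ γ) (hγδ : γ ≤ δ) (hδ : 0 < δ)
    (hδ9 : δ ≤ 1 / 9) (hh : 0 ≤ h) (hhx : h ≤ x) :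
    omegaDG β δ γ (x + h) + omegaDG β δ γ (x - h) ≤ 2 * omegaDG β δ γ x := by
  have hx := hh.trans hhx
  linarith [omegaDG_le_tangent hβ hγ hγδ hδ hδ9 hx (add_nonneg hx hh),
    omegaDG_le_tangent hβ hγ hγδ hδ hδ9 hx (sub_nonneg.2 hhx)]

lemma measurable_omegaDG {β δ γ : ℝ} (hβ : 0 ≤ β) (hγ : 0 ≤ γ) (hδ : 0 < δ) :
    Measurable (omegaDG β δ γ) := by
  have hmono : Monotone fun ξ : ℝ => ∫ η in Ioc δ ξ, γ / (4 * (η + η ^ β)) := by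
    intro x y hxy
    refine setIntegral_mono_set (slope_integrableOn hβ hγ hδ) ?_
      (Ioc_subset_Ioc_right hxy).eventuallyLE
    filter_upwards [ae_restrict_mem measurableSet_Ioc] with η hη
    exact slope_nonneg hγ (hδ.trans hη.1).le
  unfold omegaDG
  exact Measurable.ite measurableSet_Iic (by fun_prop) (measurable_const.add hmono.measurable)

lemma integrableOn_Ioi_div_rpow {a c s : ℝ} (hs : 1 < s) (hc : 0 < c) :
    IntegrableOn (fun η : ℝ => a / η ^ s) (Ioi c) := by
  have h : IntegrableOn (fun η : ℝ => a * η ^ (-s)) (Ioi c) :=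
    (integrableOn_Ioi_rpow_of_lt (neg_lt_neg hs) hc).const_mul a
  refine h.congr_fun (fun η hη => ?_) measurableSet_Ioi
  simp only [rpow_neg (hc.trans hη).le, div_eq_mul_inv]

lemma integral_Ioi_div_rpow {a c s : ℝ} (hs : 0 < s) (hc : 0 < c) :
    ∫ η in Ioi c, a / η ^ (1 + s) = a * (c ^ (-s) / s) := by
  have h := integral_Ioi_rpow_of_lt (by linarith : -(1 + s) < -1) hc
  calc ∫ η in Ioi c, a / η ^ (1 + s) = ∫ η in Ioi c, a * η ^ (-(1 + s)) :=
        setIntegral_congr_fun measurableSet_Ioi fun η hη => by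
          simp only [rpow_neg (hc.trans hη).le, div_eq_mul_inv]
    _ = a * (c ^ (-s) / s) := by
        rw [integral_const_mul, h, show -(1 + s) + 1 = -s by ring, neg_div_neg_eq]

lemma div_rpow_one_add {α η : ℝ} (hη : 0 < η) : η / η ^ (1 + α) = η ^ (-α) := by
  rw [rpow_add hη, rpow_one, rpow_neg hη.le]
  have := (rpow_pos_of_pos hη α).ne'
  field_simp

lemma div_rpow_two_add {α η : ℝ} (hη : 0 < η) : η / η ^ (2 + α) = 1 / η ^ (1 + α) := by
  rw [show 2 + α = 1 + (1 + α) by ring, div_rpow_one_add hη, rpow_neg hη.le, one_div]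

lemma integrableOn_Ioc_rpow_neg {α x : ℝ} (hα1 : α < 1) (hx : 0 ≤ x) :
    IntegrableOn (fun η : ℝ => η ^ (-α)) (Ioc 0 x) :=
  (intervalIntegrable_iff_integrableOn_Ioc_of_le hx).1
    (intervalIntegral.intervalIntegrable_rpow' (by linarith))

lemma integral_Ioc_rpow_neg {α x : ℝ} (hα1 : α < 1) (hx : 0 ≤ x) :
    ∫ η in Ioc 0 x, η ^ (-α) = x ^ (1 - α) / (1 - α) := by
  rw [← intervalIntegral.integral_of_le hx, integral_rpow (Or.inl (by linarith)),
    show -α + 1 = 1 - α by ring, zero_rpow (by linarith), sub_zero]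

lemma setIntegral_Ioc_div_rpow_le {α x : ℝ} {ω : ℝ → ℝ} (hα1 : α < 1) (hx : 0 ≤ x)
    (h0 : ∀ η, 0 ≤ η → 0 ≤ ω η) (hle : ∀ η, 0 ≤ η → ω η ≤ η) :
    ∫ η in Ioc 0 x, ω η / η ^ (1 + α) ≤ x ^ (1 - α) / (1 - α) := by
  rw [← integral_Ioc_rpow_neg hα1 hx]
  refine integral_mono_of_nonneg ?_ (integrableOn_Ioc_rpow_neg hα1 hx) ?_ <;>
    filter_upwards [ae_restrict_mem measurableSet_Ioc] with η hη
  · exact div_nonneg (h0 η hη.1.le) (rpow_nonneg hη.1.le _)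
  · rw [← div_rpow_one_add hη.1]
    exact div_le_div_of_nonneg_right (hle η hη.1.le) (rpow_nonneg hη.1.le _)

lemma setIntegral_Ioi_div_rpow_le {α a x : ℝ} {ω : ℝ → ℝ} (hα : 0 < α) (hx : 0 < x)
    (h0 : ∀ η, 0 ≤ η → 0 ≤ ω η) (hle : ∀ η, x ≤ η → ω η ≤ a * η) :
    ∫ η in Ioi x, ω η / η ^ (2 + α) ≤ a * (x ^ (-α) / α) := by
  rw [← integral_Ioi_div_rpow hα hx]
  refine integral_mono_of_nonneg ?_ (integrableOn_Ioi_div_rpow (by linarith) hx) ?_ <;>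
    filter_upwards [ae_restrict_mem measurableSet_Ioi] with η hη
  · exact div_nonneg (h0 η (hx.trans hη).le) (rpow_nonneg (hx.trans hη).le _)
  · have hη0 : 0 < η := hx.trans hη
    calc ω η / η ^ (2 + α) ≤ a * η / η ^ (2 + α) :=
          div_le_div_of_nonneg_right (hle η (le_of_lt hη)) (rpow_nonneg hη0.le _)
      _ = a / η ^ (1 + α) := by rw [mul_div_assoc, div_rpow_two_add hη0, mul_one_div]

/-- A modulus bounded by the identity has `Ω₁` of order at most `x ^ (1 - α)`. -/
lemma Omega1_le_rpow {α x : ℝ} {ω : ℝ → ℝ} (hα : 0 < α) (hα1 : α < 1) (hx : 0 < x)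
    (h0 : ∀ η, 0 ≤ η → 0 ≤ ω η) (hle : ∀ η, 0 ≤ η → ω η ≤ η) :
    Omega1 α ω x ≤ (1 / (1 - α) + 1 / α) * x ^ (1 - α) := by
  have h1 := setIntegral_Ioc_div_rpow_le hα1 hx.le h0 hle
  have h2 := setIntegral_Ioi_div_rpow_le (a := 1) hα hx h0
    (fun η hη => by rw [one_mul]; exact hle η (hx.le.trans hη))
  have h3 : x * (1 * (x ^ (-α) / α)) = x ^ (1 - α) / α := by
    rw [sub_eq_add_neg, rpow_add hx, rpow_one]; ring
  have h4 := mul_le_mul_of_nonneg_left h2 hx.le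
  rw [h3] at h4
  unfold Omega1
  calc _ ≤ x ^ (1 - α) / (1 - α) + x ^ (1 - α) / α := add_le_add h1 h4
    _ = _ := by ring

/-- Past `δ`, `Ω₁` is controlled by the modulus itself, uniformly in the argument. -/
lemma Omega1_le_mul {α δ x : ℝ} {ω : ℝ → ℝ} (hα : 0 < α) (hα1 : α < 1) (hδ : 0 < δ)
    (hx : δ ≤ x) (hm : Measurable ω) (hmono : MonotoneOn ω (Ici 0))
    (h0 : ∀ η, 0 ≤ η → 0 ≤ ω η) (hle : ∀ η, 0 ≤ η → ω η ≤ η)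
    (hlow : δ / 2 ≤ ω x) (hgrow : ∀ η, x ≤ η → ω η ≤ ω x / x * η) :
    Omega1 α ω x ≤ ω x * ((2 / (1 - α) + 2 / α) * δ ^ (-α)) := by
  have hx0 : 0 < x := hδ.trans_le hx
  have h1α : 0 < 1 - α := by linarith
  have hδα := rpow_pos_of_pos hδ (-α)
  have hInt : IntegrableOn (fun η => ω η / η ^ (1 + α)) (Ioc 0 x) := by
    refine Integrable.mono' (integrableOn_Ioc_rpow_neg hα1 hx0.le)
      (hm.div (measurable_id.pow_const _)).aestronglyMeasurable ?_
    filter_upwards [ae_restrict_mem measurableSet_Ioc] with η hη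
    rw [Real.norm_of_nonneg (div_nonneg (h0 η hη.1.le) (rpow_nonneg hη.1.le _)),
      ← div_rpow_one_add hη.1]
    exact div_le_div_of_nonneg_right (hle η hη.1.le) (rpow_nonneg hη.1.le _)
  have hsplit : ∫ η in Ioc 0 x, ω η / η ^ (1 + α) =
      (∫ η in Ioc 0 δ, ω η / η ^ (1 + α)) + ∫ η in Ioc δ x, ω η / η ^ (1 + α) := by
    rw [← Ioc_union_Ioc_eq_Ioc hδ.le hx]
    exact setIntegral_union (Ioc_disjoint_Ioc_of_le le_rfl) measurableSet_Ioc
      (hInt.mono_set (Ioc_subset_Ioc_right hx)) (hInt.mono_set (Ioc_subset_Ioc_left hδ.le))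
  have hnear := setIntegral_Ioc_div_rpow_le hα1 hδ.le h0 hle
  have hmid : ∫ η in Ioc δ x, ω η / η ^ (1 + α) ≤ ω x * (δ ^ (-α) / α) := by
    rw [← integral_Ioi_div_rpow hα hδ]
    have hω := integrableOn_Ioi_div_rpow (a := ω x) (by linarith : 1 < 1 + α) hδ
    refine le_trans (setIntegral_mono_on (hInt.mono_set (Ioc_subset_Ioc_left hδ.le))
      (hω.mono_set Ioc_subset_Ioi_self) measurableSet_Ioc fun η hη => ?_)
      (setIntegral_mono_set hω ?_ Ioc_subset_Ioi_self.eventuallyLE)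
    · have hη0 : 0 ≤ η := (hδ.trans hη.1).le
      exact div_le_div_of_nonneg_right (hmono hη0 hx0.le hη.2) (rpow_nonneg hη0 _)
    · filter_upwards [ae_restrict_mem measurableSet_Ioi] with η hη
      exact div_nonneg (h0 x hx0.le) (rpow_nonneg (hδ.trans hη).le _)
  have hfar : x * ∫ η in Ioi x, ω η / η ^ (2 + α) ≤ ω x * (δ ^ (-α) / α) := by
    have h := mul_le_mul_of_nonneg_left (setIntegral_Ioi_div_rpow_le hα hx0 h0 hgrow) hx0.le
    have hpow : x ^ (-α) ≤ δ ^ (-α) := rpow_le_rpow_of_nonpos hδ hx (by linarith)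
    calc _ ≤ x * (ω x / x * (x ^ (-α) / α)) := h
      _ = ω x * (x ^ (-α) / α) := by field_simp
      _ ≤ _ := mul_le_mul_of_nonneg_left (div_le_div_of_nonneg_right hpow hα.le) (h0 x hx0.le)
  have hδ' : δ ^ (1 - α) / (1 - α) ≤ ω x * (2 / (1 - α) * δ ^ (-α)) := by
    rw [sub_eq_add_neg 1 α, rpow_add hδ, rpow_one, ← sub_eq_add_neg]
    calc δ * δ ^ (-α) / (1 - α) = δ / 2 * (2 / (1 - α) * δ ^ (-α)) := by ring
      _ ≤ _ := by gcongr
  unfold Omega1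
  rw [hsplit]
  calc _ ≤ ω x * (2 / (1 - α) * δ ^ (-α)) + ω x * (δ ^ (-α) / α) + ω x * (δ ^ (-α) / α) := by
        linarith
    _ = _ := by ring

/-- The dissipation of a concave modulus is controlled by its defect from additivity. -/
lemma Upsilon_le {β x : ℝ} {ω : ℝ → ℝ} (hβ1 : 1 ≤ β) (hβ2 : β ≤ 2) (hx : 0 < x)
    (hm : Measurable ω) (hmono : MonotoneOn ω (Ici 0))
    (hadd : ∀ a b, 0 ≤ a → 0 ≤ b → ω (a + b) ≤ ω a + ω b)
    (hmid : ∀ h, 0 ≤ h → h ≤ x → ω (x + h) + ω (x - h) ≤ 2 * ω x) :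
    Upsilon β ω x ≤ -((2 * ω x - ω (2 * x)) * x ^ (-β)) := by
  have hx2 : 0 < x / 2 := half_pos hx
  have hβ0 : 0 < β := by linarith
  have hfirst : ∫ η in Ioc 0 (x / 2),
      (ω (x + 2 * η) + ω (x - 2 * η) - 2 * ω x) / η ^ (1 + β) ≤ 0 := by
    refine setIntegral_nonpos measurableSet_Ioc fun η hη => ?_
    refine div_nonpos_of_nonpos_of_nonneg ?_ (rpow_nonneg hη.1.le _)
    linarith [hmid (2 * η) (by linarith [hη.1]) (by linarith [hη.2])]
  have hub : ∀ η ∈ Ioi (x / 2),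
      ω (2 * η + x) - ω (2 * η - x) - 2 * ω x ≤ -(2 * ω x - ω (2 * x)) := by
    intro η hη
    have hη : x / 2 < η := hη
    have h := hadd (2 * η - x) (2 * x) (by linarith) (by linarith)
    rw [show 2 * η - x + 2 * x = 2 * η + x by ring] at h
    linarith
  have hlb : ∀ η ∈ Ioi (x / 2), -(2 * ω x) ≤ ω (2 * η + x) - ω (2 * η - x) - 2 * ω x := by
    intro η hη
    have hη : x / 2 < η := hη
    have h := hmono (show 2 * η - x ∈ Ici (0 : ℝ) from mem_Ici.2 (by linarith))
      (show 2 * η + x ∈ Ici (0 : ℝ) from mem_Ici.2 (by linarith)) (by linarith)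
    linarith
  have hInt : IntegrableOn (fun η => (ω (2 * η + x) - ω (2 * η - x) - 2 * ω x) / η ^ (1 + β))
      (Ioi (x / 2)) := by
    refine Integrable.mono' (integrableOn_Ioi_div_rpow
      (a := |2 * ω x| + |2 * ω x - ω (2 * x)|) (by linarith : 1 < 1 + β) hx2)
      (Measurable.aestronglyMeasurable (by fun_prop)) ?_
    filter_upwards [ae_restrict_mem measurableSet_Ioi] with η hη
    have hp : 0 ≤ η ^ (1 + β) := rpow_nonneg (hx2.trans hη).le _
    rw [norm_div, Real.norm_of_nonneg hp]
    refine div_le_div_of_nonneg_right (abs_le.2 ⟨?_, ?_⟩) hp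
    · linarith [hlb η hη, le_abs_self (2 * ω x), abs_nonneg (2 * ω x - ω (2 * x))]
    · linarith [hub η hη, neg_le_abs (2 * ω x - ω (2 * x)), abs_nonneg (2 * ω x)]
  have hsecond : ∫ η in Ioi (x / 2),
      (ω (2 * η + x) - ω (2 * η - x) - 2 * ω x) / η ^ (1 + β) ≤
        -(2 * ω x - ω (2 * x)) * ((x / 2) ^ (-β) / β) := by
    rw [← integral_Ioi_div_rpow hβ0 hx2]
    refine setIntegral_mono_on hInt (integrableOn_Ioi_div_rpow (by linarith) hx2)
      measurableSet_Ioi fun η hη => ?_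
    exact div_le_div_of_nonneg_right (hub η hη) (rpow_nonneg (hx2.trans hη).le _)
  have hscale : x ^ (-β) ≤ (x / 2) ^ (-β) / β := by
    have h2 : (2 : ℝ) ≤ 2 ^ β := by
      simpa using rpow_le_rpow_of_exponent_le (one_le_two : (1 : ℝ) ≤ 2) hβ1
    rw [div_rpow hx.le zero_le_two, rpow_neg zero_le_two, div_inv_eq_mul, le_div_iff₀ hβ0]
    exact mul_le_mul_of_nonneg_left (hβ2.trans h2) (rpow_nonneg hx.le _)
  have hdef : 0 ≤ 2 * ω x - ω (2 * x) := by
    have := hadd x x hx.le hx.le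
    rw [← two_mul] at this
    linarith
  unfold Upsilon
  linarith [mul_le_mul_of_nonneg_left hscale hdef]

lemma omegaDG_half_le {β δ γ x : ℝ} (hβ : 0 ≤ β) (hγ : 0 ≤ γ) (hγδ : γ ≤ δ) (hδ : 0 < δ)
    (hδ9 : δ ≤ 1 / 9) (hx : δ ≤ x) : δ / 2 ≤ omegaDG β δ γ x := by
  have h := omegaDG_monotoneOn hβ hγ hγδ hδ hδ9 (mem_Ici.2 hδ.le)
    (mem_Ici.2 (hδ.le.trans hx)) hx
  have h1 : δ ^ ((3 : ℝ) / 2) = δ * δ ^ ((1 : ℝ) / 2) := by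
    rw [show (3 : ℝ) / 2 = 1 + 1 / 2 by norm_num, rpow_add hδ, rpow_one]
  have h2 := half_le_one_sub_sqrt hδ9
  rw [omegaDG, if_pos le_rfl, h1] at h
  nlinarith

lemma mul_slope_le {β γ x : ℝ} (hγ : 0 ≤ γ) (hx : 0 < x) :
    γ / (4 * (x + x ^ β)) * x ≤ γ / 4 := by
  have hp := rpow_pos_of_pos hx β
  rw [div_mul_eq_mul_div, div_le_div_iff₀ (by positivity) (by norm_num)]
  nlinarith [mul_nonneg hγ hp.le]

lemma key_inequality_near {α β δ γ a b x : ℝ} (hα : 0 < α) (hα1 : α < 1) (hβ : α + 1 < β)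
    (hβ2 : β < 2) (hγ : 0 ≤ γ) (hγδ : γ ≤ δ) (hδ : 0 < δ) (hδ9 : δ ≤ 1 / 9) (ha : 0 < a)
    (hb : 0 < b) (hsmall : a * (1 / (1 - α) + 1 / α) * √δ < b / 2) (hx : 0 < x) (hxδ : x ≤ δ) :
    a * Omega1 α (omegaDG β δ γ) x * (1 - (3 / 2) * x ^ ((1 : ℝ) / 2)) +
      b * Upsilon β (omegaDG β δ γ) x < 0 := by
  have hβ0 : 0 ≤ β := by linarith
  have h1α : 0 < 1 - α := by linarith
  have hK : 0 < 1 / (1 - α) + 1 / α := by positivity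
  have hΩ := Omega1_le_rpow hα hα1 hx (fun η => omegaDG_nonneg hβ0 hγ hγδ hδ hδ9)
    (fun η => omegaDG_le_self hβ0 hγ hγδ hδ hδ9)
  have hΥ := Upsilon_le (by linarith) hβ2.le hx (measurable_omegaDG hβ0 hγ hδ)
    (omegaDG_monotoneOn hβ0 hγ hγδ hδ hδ9) (fun _ _ => omegaDG_add_le hβ0 hγ hγδ hδ hδ9)
    (fun _ => omegaDG_add_sub_le hβ0 hγ hγδ hδ hδ9)
  have hD0 := half_le_one_sub_sqrt (hxδ.trans hδ9)
  have hD1 : 1 - (3 / 2) * x ^ ((1 : ℝ) / 2) ≤ 1 := by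
    linarith [rpow_nonneg hx.le ((1 : ℝ) / 2)]
  have hpow : x ^ ((3 : ℝ) / 2) = x * x ^ ((1 : ℝ) / 2) := by
    rw [show (3 : ℝ) / 2 = 1 + 1 / 2 by norm_num, rpow_add hx, rpow_one]
  have hdef : x ^ ((3 : ℝ) / 2) / 2 ≤ 2 * omegaDG β δ γ x - omegaDG β δ γ (2 * x) := by
    have h := omegaDG_le_tangent hβ0 hγ hγδ hδ hδ9 hx.le (by linarith : 0 ≤ 2 * x)
    have hω : omegaDG β δ γ x = x - x ^ ((3 : ℝ) / 2) := by rw [omegaDG, if_pos hxδ]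
    rw [omegaDGSlope, if_pos hxδ, hω] at h
    rw [hω]
    linarith
  have hxp := rpow_pos_of_pos hx (3 / 2 - β)
  have hΥ' : Upsilon β (omegaDG β δ γ) x ≤ -(x ^ (3 / 2 - β) / 2) := by
    have h := mul_le_mul_of_nonneg_right hdef (rpow_nonneg hx.le (-β))
    rw [sub_eq_add_neg (3 / 2 : ℝ), rpow_add hx]
    linarith
  have hcomp : x ^ (1 - α) ≤ √δ * x ^ (3 / 2 - β) := by
    calc x ^ (1 - α) ≤ x ^ (1 / 2 + (3 / 2 - β)) :=
          rpow_le_rpow_of_exponent_ge hx (by linarith) (by linarith)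
      _ = √x * x ^ (3 / 2 - β) := by rw [rpow_add hx, Real.sqrt_eq_rpow]
      _ ≤ _ := mul_le_mul_of_nonneg_right (Real.sqrt_le_sqrt hxδ) hxp.le
  have hM : 0 ≤ a * ((1 / (1 - α) + 1 / α) * x ^ (1 - α)) := by positivity
  calc _ ≤ a * ((1 / (1 - α) + 1 / α) * x ^ (1 - α)) * 1 + b * -(x ^ (3 / 2 - β) / 2) := by
        refine add_le_add ?_ (mul_le_mul_of_nonneg_left hΥ' hb.le)
        exact mul_le_mul (mul_le_mul_of_nonneg_left hΩ ha.le) hD1 (by linarith) hM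
    _ ≤ a * ((1 / (1 - α) + 1 / α) * (√δ * x ^ (3 / 2 - β))) * 1 +
          b * -(x ^ (3 / 2 - β) / 2) := by gcongr
    _ = (a * (1 / (1 - α) + 1 / α) * √δ - b / 2) * x ^ (3 / 2 - β) := by ring
    _ < 0 := mul_neg_of_neg_of_pos (by linarith) hxp

lemma key_inequality_far {α β δ γ a b x : ℝ} (hα : 0 < α) (hα1 : α < 1) (hβ : 1 ≤ β)
    (hβ2 : β ≤ 2) (hγ : 0 ≤ γ) (hγδ : γ ≤ δ) (hδ : 0 < δ) (hδ9 : δ ≤ 1 / 9) (ha : 0 < a)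
    (hb : 0 < b) (hsmall : a * ((2 / (1 - α) + 2 / α) * δ ^ (-α)) * γ < b / 2) (hx : δ < x) :
    a * Omega1 α (omegaDG β δ γ) x * (γ / (4 * (x + x ^ β))) +
      b * Upsilon β (omegaDG β δ γ) x < 0 := by
  have hβ0 : 0 ≤ β := by linarith
  have hx0 : 0 < x := hδ.trans hx
  have h1α : 0 < 1 - α := by linarith
  have hδα := rpow_pos_of_pos hδ (-α)
  have hlow := omegaDG_half_le hβ0 hγ hγδ hδ hδ9 hx.le
  have hω0 : 0 < omegaDG β δ γ x := by linarith
  have hslope := mul_slope_le (β := β) hγ hx0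
  have htan : ∀ y, 0 ≤ y → omegaDG β δ γ y ≤
      omegaDG β δ γ x + γ / (4 * (x + x ^ β)) * (y - x) := by
    intro y hy
    simpa only [omegaDGSlope, if_neg hx.not_ge] using
      omegaDG_le_tangent hβ0 hγ hγδ hδ hδ9 hx0.le hy
  have hgrow : ∀ η, x ≤ η → omegaDG β δ γ η ≤ omegaDG β δ γ x / x * η := by
    intro η hη
    have h := htan η (hx0.le.trans hη)
    have h' : γ / (4 * (x + x ^ β)) ≤ omegaDG β δ γ x / x := by
      rw [le_div_iff₀ hx0]; linarith
    calc _ ≤ omegaDG β δ γ x + omegaDG β δ γ x / x * (η - x) :=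
          h.trans (add_le_add_right (mul_le_mul_of_nonneg_right h' (sub_nonneg.2 hη)) _)
      _ = _ := by field_simp; ring
  have hΩ := Omega1_le_mul hα hα1 hδ hx.le (measurable_omegaDG hβ0 hγ hδ)
    (omegaDG_monotoneOn hβ0 hγ hγδ hδ hδ9) (fun η => omegaDG_nonneg hβ0 hγ hγδ hδ hδ9)
    (fun η => omegaDG_le_self hβ0 hγ hγδ hδ hδ9) hlow hgrow
  have hΥ := Upsilon_le hβ hβ2 hx0 (measurable_omegaDG hβ0 hγ hδ)
    (omegaDG_monotoneOn hβ0 hγ hγδ hδ hδ9) (fun _ _ => omegaDG_add_le hβ0 hγ hγδ hδ hδ9)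
    (fun _ => omegaDG_add_sub_le hβ0 hγ hγδ hδ hδ9)
  have hdef : omegaDG β δ γ x / 2 ≤ 2 * omegaDG β δ γ x - omegaDG β δ γ (2 * x) := by
    linarith [htan (2 * x) (by linarith)]
  have hxp := rpow_pos_of_pos hx0 (-β)
  have hΥ' : Upsilon β (omegaDG β δ γ) x ≤ -(omegaDG β δ γ x / 2 * x ^ (-β)) :=
    hΥ.trans (neg_le_neg (mul_le_mul_of_nonneg_right hdef hxp.le))
  have hD : γ / (4 * (x + x ^ β)) ≤ γ * x ^ (-β) := by
    have hp := rpow_pos_of_pos hx0 β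
    rw [rpow_neg hx0.le, ← div_eq_mul_inv]
    exact div_le_div_of_nonneg_left hγ hp (by linarith)
  calc _ ≤ a * (omegaDG β δ γ x * ((2 / (1 - α) + 2 / α) * δ ^ (-α))) * (γ * x ^ (-β)) +
          b * -(omegaDG β δ γ x / 2 * x ^ (-β)) := by
        refine add_le_add ?_ (mul_le_mul_of_nonneg_left hΥ' hb.le)
        exact mul_le_mul (mul_le_mul_of_nonneg_left hΩ ha.le) hD (slope_nonneg hγ hx0.le)
          (by positivity)
    _ = (a * ((2 / (1 - α) + 2 / α) * δ ^ (-α)) * γ - b / 2) *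
          (omegaDG β δ γ x * x ^ (-β)) := by ring
    _ < 0 := mul_neg_of_neg_of_pos (by linarith) (mul_pos hω0 hxp)

lemma exists_pos_lt_mul_lt {A B C : ℝ} (hA : 0 < A) (hB : 0 < B) (hC : 0 < C) :
    ∃ t, 0 < t ∧ t < C ∧ A * t < B := by
  obtain ⟨t, ht0, ht⟩ := exists_between (lt_min hC (div_pos hB hA))
  exact ⟨t, ht0, ht.trans_le (min_le_left _ _),
    (lt_div_iff₀' hA).1 (ht.trans_le (min_le_right _ _))⟩

/-- the key differential inequality of Section 4 for the subcritical case. -/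
theorem stmt0 (α β ν cα cβ : ℝ)
    (hα : α ∈ Set.Ioo (0 : ℝ) 1) (hβ : β ∈ Set.Ioo (α + 1) 2)
    (hν : 0 < ν) (hcα : 0 < cα) (hcβ : 0 < cβ) :
    ∃ δ γ : ℝ, 0 < γ ∧ γ < δ ∧ δ ≤ 1 / 9 ∧
      ∀ ξ > (0 : ℝ),
        cα * Omega1 α (omegaDG β δ γ) ξ *
            (if ξ ≤ δ then 1 - (3 / 2) * ξ ^ ((1 : ℝ) / 2)
             else γ / (4 * (ξ + ξ ^ β))) +
          ν * cβ * Upsilon β (omegaDG β δ γ) ξ < 0 := by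
  obtain ⟨hα0, hα1⟩ := hα
  obtain ⟨hβ1, hβ2⟩ := hβ
  have h1α : 0 < 1 - α := by linarith
  have hb : 0 < ν * cβ := mul_pos hν hcβ
  obtain ⟨s, hs0, hs3, hs⟩ := exists_pos_lt_mul_lt
    (by positivity : 0 < cα * (1 / (1 - α) + 1 / α)) (half_pos hb) (by norm_num : (0 : ℝ) < 1 / 3)
  have hδ : 0 < s ^ 2 := by positivity
  have hδ9 : s ^ 2 ≤ 1 / 9 := by nlinarith
  obtain ⟨γ, hγ, hγδ, hsmall⟩ := exists_pos_lt_mul_lt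
    (by positivity : 0 < cα * ((2 / (1 - α) + 2 / α) * (s ^ 2) ^ (-α))) (half_pos hb) hδ
  refine ⟨s ^ 2, γ, hγ, hγδ, hδ9, fun ξ hξ => ?_⟩
  split_ifs with h
  · exact key_inequality_near hα0 hα1 hβ1 hβ2 hγ.le hγδ.le hδ hδ9 hcα hb
      (by rwa [sqrt_sq hs0.le]) hξ h
  · exact key_inequality_far hα0 hα1 (by linarith) hβ2.le hγ.le hγδ.le hδ hδ9 hcα hb hsmall
      (not_le.1 h)
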